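/- Let L = L_1 ∪ L_2 with L_1 ∩ L_2 = ∅, let T_i' be an L_i-theory with model companion T_i ⊇ T_i' for i = 1, 2, where each T_i eliminates ∃^∞ and all of T_1, T_1', T_2, T_2' have only infinite models. Let T̃ be the L-theory axiomatized by T_1 ∪ T_2 together with, for all L_1-formulas φ_1(x̄, ȳ) and L_2-formulas φ_2(x̄, ȳ), the sentence ∀ȳ [ (λ^{T_1}_{x̄}φ_1(ȳ) ∧ λ^{T_2}_{x̄}φ_2(ȳ)) → ∃x̄ (φ_1(x̄, ȳ) ∧ φ_2(x̄, ȳ)) ]. Then T̃ is the model companion of T_1' ∪ T_2'; consequently, T̃ is also the model companion of T_1 ∪ T_2', T_1' ∪ T_2, and T_1 ∪ T_2. -/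

import Mathlib

open FirstOrder FirstOrder.Language

universe u v

namespace NATPPaper

variable {L : FirstOrder.Language.{u, v}}

/-- Model-theoretic algebraic closure. -/
def acl (L : FirstOrder.Language.{u, v}) (M : Type w) [L.Structure M] (A : Set M) : Set M :=
  {x | ∃ (k : ℕ) (φ : L.Formula (Fin 1 ⊕ Fin k)) (c : Fin k → M),
        (∀ j, c j ∈ A) ∧ φ.Realize (Sum.elim (fun _ => x) c) ∧
        {y : M | φ.Realize (Sum.elim (fun _ => y) c)}.Finite}

/-- `φ(x̄, b̄)` is large (in the sense of Definition 4.1): in some elementary extension there is a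
tuple `ā` of pairwise distinct realizations of `φ(x̄, b̄)` avoiding `acl(b̄)`. -/
def IsLargeIn {k m : ℕ} (φ : L.Formula (Fin k ⊕ Fin m))
    (M : Type (max u v)) [L.Structure M] (b : Fin m → M) : Prop :=
  ∃ (N : Type (max u v)) (SN : L.Structure N)
    (f : @Language.ElementaryEmbedding L M N _ SN) (a : Fin k → N),
    Function.Injective a ∧ (∀ i, a i ∉ @acl L N SN (Set.range (⇑f ∘ b))) ∧
    @Formula.Realize L N SN _ φ (Sum.elim a (⇑f ∘ b))

/-- `T` eliminates the quantifier `∃^∞`. -/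
def EliminatesExInf (T : L.Theory) : Prop :=
  ∀ (k : ℕ) (φ : L.Formula (Fin 1 ⊕ Fin k)), ∃ N : ℕ,
    ∀ (M : Theory.ModelType.{u, v, max u v} T) (c : Fin k → M),
      (∃ s : Finset M, N ≤ s.card ∧ ∀ x ∈ s, φ.Realize (Sum.elim (fun _ => x) c)) →
      {x : (M : Type (max u v)) | φ.Realize (Sum.elim (fun _ => x) c)}.Infinite

/-- `T` is model complete: every embedding between models of `T` is elementary. -/
def IsModelComplete (T : L.Theory) : Prop :=
  ∀ (M N : Type (max u v)) [L.Structure M] [L.Structure N],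
    M ⊨ T → N ⊨ T → ∀ (f : M ↪[L] N) (n : ℕ) (φ : L.Formula (Fin n)) (w : Fin n → M),
      φ.Realize (⇑f ∘ w) ↔ φ.Realize w

/-- `Tc` is the model companion of `T₀`: `Tc` is model complete, and each of `Tc`, `T₀` has the
property that every model of one embeds into a model of the other. -/
def IsModelCompanion (Tc T₀ : L.Theory) : Prop :=
  IsModelComplete Tc ∧
  (∀ (M : Type (max u v)) [L.Structure M], M ⊨ T₀ →
      ∃ (N : Type (max u v)) (SN : L.Structure N),
        @Theory.Model L N SN Tc ∧ Nonempty (@Language.Embedding L M N _ SN)) ∧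
  (∀ (N : Type (max u v)) [L.Structure N], N ⊨ Tc →
      ∃ (M : Type (max u v)) (SM : L.Structure M),
        @Theory.Model L M SM T₀ ∧ Nonempty (@Language.Embedding L N M _ SM))

/-- A theory has only infinite models. -/
def OnlyInfiniteModels (T : L.Theory) : Prop :=
  ∀ (M : Type (max u v)) [L.Structure M], M ⊨ T → Infinite M


section Companion

/-- The semantic content of the genericity axioms of `T̃`: whenever `φ₁(x̄, b̄)` is large in `T₁`
and `φ₂(x̄, b̄)` is large in `T₂`, there is a common realization `ā` of `φ₁(x̄, b̄) ∧ φ₂(x̄, b̄)`. -/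
def GenericityAxioms (L₁ L₂ : FirstOrder.Language.{u, v})
    (M : Type (max u v)) [(L₁.sum L₂).Structure M] : Prop :=
  ∀ (k m : ℕ) (φ₁ : L₁.Formula (Fin k ⊕ Fin m)) (φ₂ : L₂.Formula (Fin k ⊕ Fin m))
    (b : Fin m → M),
    @IsLargeIn L₁ k m φ₁ M ((LHom.sumInl : L₁ →ᴸ L₁.sum L₂).reduct M) b →
    @IsLargeIn L₂ k m φ₂ M ((LHom.sumInr : L₂ →ᴸ L₁.sum L₂).reduct M) b →
    ∃ a : Fin k → M,
      (@Formula.Realize L₁ M ((LHom.sumInl : L₁ →ᴸ L₁.sum L₂).reduct M) _ φ₁ (Sum.elim a b)) ∧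
      (@Formula.Realize L₂ M ((LHom.sumInr : L₂ →ᴸ L₁.sum L₂).reduct M) _ φ₂ (Sum.elim a b))

theorem exists_ultralimit {M α I : Type (max u v)} [L.Structure M] [Nonempty M]
    (l : Filter I) [l.NeBot] (g : I → α → M) :
    ∃ (N : Type (max u v)) (_ : L.Structure N) (e : M ↪ₑ[L] N) (g' : α → N),
      ∀ ψ : L.Formula (M ⊕ α), (∀ᶠ i in l, ψ.Realize (Sum.elim id (g i))) →
        ψ.Realize (Sum.elim e g') := by
  let U : Ultrafilter I := Ultrafilter.of l
  let e : M ↪ₑ[L] (U : Filter I).Product (fun _ => M) :=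
    { toFun := fun x => ((fun _ => x : I → M) : (U : Filter I).Product (fun _ => M))
      map_formula' := fun n φ x => by
        have := Ultraproduct.realize_formula_cast (u := U) φ (fun j (_ : I) => x j)
        rw [Filter.eventually_const] at this
        exact this }
  refine ⟨(U : Filter I).Product (fun _ => M), inferInstance, e,
    fun a => ((fun i => g i a : I → M) : (U : Filter I).Product (fun _ => M)), fun ψ hψ => ?_⟩
  have key := Ultraproduct.realize_formula_cast (u := U) ψ
    (Sum.elim (fun (x : M) (_ : I) => x) (fun a i => g i a))
  have h₁ : (fun j => ((Sum.elim (fun (x : M) (_ : I) => x) (fun a i => g i a) j : I → M) :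
      (U : Filter I).Product (fun _ => M))) = Sum.elim e
        (fun a => ((fun i => g i a : I → M) : (U : Filter I).Product (fun _ => M))) := by
    funext j
    cases j <;> rfl
  rw [← h₁]
  refine key.2 (Filter.Eventually.mono (Ultrafilter.of_le l hψ) fun i hi => ?_)
  convert hi using 1
  funext j
  cases j <;> rfl

/-- There are only finitely many hitting sets of minimum size for a family of finite tuples. -/
theorem finite_setOf_minimum_hitting {X ι : Type*} [Finite ι] (n : ℕ) :
    ∀ F : Set (ι → X), (∀ H : Finset X, (∀ e ∈ F, ∃ i, e i ∈ H) → n ≤ H.card) →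
      {H : Finset X | H.card = n ∧ ∀ e ∈ F, ∃ i, e i ∈ H}.Finite := by
  classical
  induction n with
  | zero =>
    intro F _
    exact (Set.finite_singleton ∅).subset fun H hH => Finset.card_eq_zero.1 hH.1
  | succ n ih =>
    intro F hF
    obtain ⟨e, he⟩ : F.Nonempty := by
      by_contra hne
      have := hF ∅ (by simp [Set.not_nonempty_iff_eq_empty.1 hne])
      simp at this
    refine (Set.finite_iUnion fun i => (ih {e' ∈ F | ∀ j, e' j ≠ e i} ?_).image
      (insert (e i))).subset ?_
    · intro H hH
      have := hF (insert (e i) H) fun e' he' => by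
        by_cases h : ∀ j, e' j ≠ e i
        · obtain ⟨j, hj⟩ := hH e' ⟨he', h⟩
          exact ⟨j, Finset.mem_insert_of_mem hj⟩
        · push Not at h
          obtain ⟨j, hj⟩ := h
          exact ⟨j, by simp [hj]⟩
      have := Finset.card_insert_le (e i) H
      omega
    · rintro H ⟨hcard, hH⟩
      obtain ⟨i, hi⟩ := hH e he
      refine Set.mem_iUnion.2 ⟨i, H.erase (e i), ⟨?_, ?_⟩, Finset.insert_erase hi⟩
      · rw [Finset.card_erase_of_mem hi, hcard]
        rfl
      · rintro e' ⟨he', hne⟩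
        obtain ⟨j, hj⟩ := hH e' he'
        exact ⟨j, Finset.mem_erase.2 ⟨hne j, hj⟩⟩

theorem exists_injective_formula {k : ℕ} {β : Type*} (φ : L.Formula (Fin k ⊕ β)) :
    ∃ ψ : L.Formula (Fin k ⊕ β), ∀ (M : Type (max u v)) [L.Structure M] (a : Fin k → M) (v : β → M),
      ψ.Realize (Sum.elim a v) ↔ φ.Realize (Sum.elim a v) ∧ Function.Injective a := by
  refine ⟨φ ⊓ Formula.iInf fun p : {p : Fin k × Fin k // p.1 ≠ p.2} =>
    ((Term.var (Sum.inl p.1.1)).equal (Term.var (Sum.inl p.1.2))).not, fun M _ a v => ?_⟩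
  simp only [Formula.realize_inf, Formula.realize_iInf, Formula.realize_not, Formula.realize_equal,
    Term.realize_var, Sum.elim_inl, Subtype.forall, Prod.forall]
  refine and_congr_right fun _ => ⟨fun h i j hij => ?_, fun h i j hij heq => hij (h heq)⟩
  by_contra hne
  exact h i j hne hij

theorem exists_hitting_formula {k : ℕ} {β γ : Type*} [Finite γ] (φ : L.Formula (Fin k ⊕ β)) :
    ∃ ψ : L.Formula (β ⊕ γ), ∀ (M : Type (max u v)) [L.Structure M] (v : β → M) (z : γ → M),
      ψ.Realize (Sum.elim v z) ↔ ∀ a : Fin k → M, φ.Realize (Sum.elim a v) → ∃ i j, a i = z j := by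
  refine ⟨Formula.iAlls (Fin k) ((φ.relabel (Sum.elim Sum.inr (Sum.inl ∘ Sum.inl))).imp
    (Formula.iSup fun p : Fin k × γ =>
      (Term.var (Sum.inr p.1)).equal (Term.var (Sum.inl (Sum.inr p.2))))), fun M _ v z => ?_⟩
  simp only [Formula.realize_iAlls, Formula.realize_imp, Formula.realize_relabel,
    Formula.realize_iSup, Formula.realize_equal, Term.realize_var, Sum.elim_inr, Sum.elim_inl,
    Prod.exists]
  refine forall_congr' fun a => imp_congr ?_ Iff.rfl
  refine iff_of_eq (congrArg _ ?_)
  funext x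
  cases x <;> rfl

theorem acl_range_comp_subset {M N : Type (max u v)} [L.Structure M] [L.Structure N]
    (e : M ↪ₑ[L] N) {β : Type*} (b : β → M) : acl L N (Set.range (e ∘ b)) ⊆ Set.range e := by
  rintro x ⟨k, φ, c, hc, hx, hfin⟩
  choose c' hc' using hc
  obtain rfl : e ∘ b ∘ c' = c := funext hc'
  have hiff : ∀ (a : Fin 1 → M), φ.Realize (Sum.elim (e ∘ a) (e ∘ b ∘ c')) ↔
      φ.Realize (Sum.elim a (b ∘ c')) := fun a => by
    rw [← Sum.comp_elim, e.map_formula]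
  have hfinM : {y : M | φ.Realize (Sum.elim (fun _ => y) (b ∘ c'))}.Finite :=
    (hfin.preimage e.injective.injOn).subset fun y hy => (hiff fun _ => y).2 hy
  have := hfinM.to_subtype
  obtain ⟨ψ, hψ⟩ := exists_hitting_formula
    (γ := {y : M | φ.Realize (Sum.elim (fun _ => y) (b ∘ c'))}) φ
  have h₁ : ψ.Realize (Sum.elim (b ∘ c') (Subtype.val)) := (hψ M _ _).2 fun a ha => by
    have h0 : (fun _ => a 0) = a := funext fun i => by rw [Subsingleton.elim i 0]
    exact ⟨0, ⟨a 0, by rw [Set.mem_ofPred_eq, h0]; exact ha⟩, rfl⟩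
  rw [← e.map_formula, Sum.comp_elim, hψ] at h₁
  obtain ⟨-, j, hj⟩ := h₁ _ hx
  exact ⟨_, hj.symm⟩

/-- A form of P. M. Neumann's lemma: a large formula has realizations avoiding any finite set. -/
theorem IsLargeIn.exists_realize_avoiding {k m : ℕ} {φ : L.Formula (Fin k ⊕ Fin m)}
    {M : Type (max u v)} [L.Structure M] {b : Fin m → M} (h : IsLargeIn φ M b) (F : Finset M) :
    ∃ a : Fin k → M, Function.Injective a ∧ (∀ i, a i ∉ F) ∧ φ.Realize (Sum.elim a b) := by
  classical
  by_contra! hcon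
  obtain ⟨N, _, f, a, hinj, hacl, ha⟩ := h
  obtain ⟨φ', hφ'⟩ := exists_injective_formula φ
  have hhit : ∃ n, ∃ H : Finset N, H.card = n ∧
      ∀ e : Fin k → N, φ'.Realize (Sum.elim e (f ∘ b)) → ∃ i, e i ∈ H := by
    obtain ⟨ψ, hψ⟩ := exists_hitting_formula (γ := F) φ'
    have h₁ : ψ.Realize (Sum.elim b Subtype.val) := (hψ M _ _).2 fun c hc => by
      rw [hφ'] at hc
      have : ∃ i, c i ∈ F := by
        by_contra! h
        exact hcon c hc.2 h hc.1
      obtain ⟨i, hi⟩ := this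
      exact ⟨i, ⟨c i, hi⟩, rfl⟩
    rw [← f.map_formula, Sum.comp_elim, hψ] at h₁
    refine ⟨_, F.image f, rfl, fun e he => ?_⟩
    obtain ⟨i, j, hij⟩ := h₁ e he
    exact ⟨i, hij ▸ Finset.mem_image_of_mem f j.2⟩
  obtain ⟨H, hcard, hH⟩ := Nat.find_spec hhit
  set n := Nat.find hhit
  have hmin : ∀ H' : Finset N, (∀ e ∈ {e : Fin k → N | φ'.Realize (Sum.elim e (f ∘ b))},
      ∃ i, e i ∈ H') → n ≤ H'.card := fun H' hH' => Nat.find_min' hhit ⟨H', rfl, hH'⟩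
  have hfin := finite_setOf_minimum_hitting n _ hmin
  obtain ⟨i, hi⟩ := hH a ((hφ' N _ _).2 ⟨ha, hinj⟩)
  obtain ⟨χ, hχ⟩ := exists_hitting_formula (γ := Fin n) φ'
  let θ : L.Formula (Fin 1 ⊕ Fin m) := Formula.iExs (Fin n)
    ((Formula.iSup fun j : Fin n => (Term.var (Sum.inl (Sum.inl 0))).equal (Term.var (Sum.inr j))) ⊓
      χ.relabel (Sum.map Sum.inr id))
  have hθ : ∀ y : N, θ.Realize (Sum.elim (fun _ => y) (f ∘ b)) ↔ ∃ z : Fin n → N,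
      (∃ j, y = z j) ∧ ∀ e : Fin k → N, φ'.Realize (Sum.elim e (f ∘ b)) → ∃ i j, e i = z j := by
    intro y
    simp only [θ, Formula.realize_iExs, Formula.realize_inf, Formula.realize_iSup,
      Formula.realize_equal, Term.realize_var, Sum.elim_inl, Sum.elim_inr, Formula.realize_relabel]
    refine exists_congr fun z => and_congr Iff.rfl ?_
    rw [← hχ N]
    refine iff_of_eq (congrArg _ ?_)
    funext x
    cases x <;> rfl
  refine hacl i ⟨m, θ, f ∘ b, fun j => ⟨j, rfl⟩, (hθ _).2 ?_,
    (hfin.biUnion fun H' _ => H'.finite_toSet).subset fun y hy => ?_⟩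
  · let z := (H.equivFinOfCardEq hcard).symm
    have hz : ∀ x ∈ H, ∃ j, x = z j := fun x hx => ⟨z.symm ⟨x, hx⟩, by simp⟩
    refine ⟨fun j => z j, hz _ hi, fun e he => ?_⟩
    obtain ⟨i', hi'⟩ := hH e he
    exact ⟨i', hz _ hi'⟩
  · obtain ⟨z, ⟨j, rfl⟩, hz⟩ := (hθ y).1 hy
    have hz' : ∀ e ∈ {e : Fin k → N | φ'.Realize (Sum.elim e (f ∘ b))},
        ∃ i, e i ∈ Finset.univ.image z := fun e he => by
      obtain ⟨i, j, hij⟩ := hz e he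
      exact ⟨i, by simp [hij]⟩
    have hle : (Finset.univ.image z).card ≤ n := by
      simpa using Finset.card_image_le (s := Finset.univ) (f := z)
    exact Set.mem_biUnion (x := Finset.univ.image z) ⟨le_antisymm hle (hmin _ hz'), hz'⟩ (by simp)

theorem exists_disjoint_realizations {M ι : Type (max u v)} [L.Structure M] [Nonempty M]
    (k m : ι → ℕ) (φ : ∀ t, L.Formula (Fin (k t) ⊕ Fin (m t))) (b : ∀ t, Fin (m t) → M)
    (h : ∀ t, IsLargeIn (φ t) M (b t)) (S : Finset ι) (F : Finset M) :
    ∃ a : ∀ t, Fin (k t) → M,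
      (∀ t ∈ S, Function.Injective (a t) ∧ (∀ i, a t i ∉ F) ∧
        (φ t).Realize (Sum.elim (a t) (b t))) ∧
      ∀ t ∈ S, ∀ t' ∈ S, t ≠ t' → ∀ i j, a t i ≠ a t' j := by
  classical
  induction S using Finset.induction_on with
  | empty => exact ⟨fun _ _ => Classical.arbitrary M, by simp, by simp⟩
  | insert s S hs ih =>
    obtain ⟨a, ha, hdisj⟩ := ih
    obtain ⟨c, hinj, hav, hc⟩ :=
      (h s).exists_realize_avoiding (F ∪ S.biUnion fun t => Finset.univ.image (a t))
    have hcF : ∀ i, c i ∉ F := fun i hi => hav i (Finset.mem_union_left _ hi)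
    have hca : ∀ i, ∀ t ∈ S, ∀ j, c i ≠ a t j := fun i t ht j hij =>
      hav i (Finset.mem_union_right _ (Finset.mem_biUnion.2 ⟨t, ht, by simp [hij]⟩))
    have hne : ∀ t ∈ S, t ≠ s := fun t ht hts => hs (hts ▸ ht)
    refine ⟨Function.update a s c, fun t ht => ?_, fun t ht t' ht' htt' i j => ?_⟩
    · rcases Finset.mem_insert.1 ht with rfl | ht
      · simp only [Function.update_self]
        exact ⟨hinj, hcF, hc⟩
      · simp only [Function.update_of_ne (hne t ht)]
        exact ha t ht
    · rcases Finset.mem_insert.1 ht with hts | hm <;> rcases Finset.mem_insert.1 ht' with hts' | hm'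
      · exact (htt' (hts.trans hts'.symm)).elim
      · subst hts
        rw [Function.update_self, Function.update_of_ne (hne t' hm')]
        exact hca i t' hm' j
      · subst hts'
        rw [Function.update_self, Function.update_of_ne (hne t hm)]
        exact (hca j t hm i).symm
      · rw [Function.update_of_ne (hne t hm), Function.update_of_ne (hne t' hm')]
        exact hdisj t hm t' hm' htt' i j

theorem exists_elementaryEmbedding_realize_family {M ι : Type (max u v)} [L.Structure M]
    [Nonempty M] (k m : ι → ℕ) (φ : ∀ t, L.Formula (Fin (k t) ⊕ Fin (m t)))
    (b : ∀ t, Fin (m t) → M) (h : ∀ t, IsLargeIn (φ t) M (b t)) :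
    ∃ (N : Type (max u v)) (_ : L.Structure N) (e : M ↪ₑ[L] N) (a : (Σ t, Fin (k t)) → N),
      Function.Injective (Sum.elim e a) ∧
      ∀ t, (φ t).Realize (Sum.elim (fun i => a ⟨t, i⟩) (e ∘ b t)) := by
  classical
  choose g hg hdisj using fun p : Finset ι × Finset M =>
    exists_disjoint_realizations k m φ b h p.1 p.2
  obtain ⟨N, SN, e, a, H⟩ := exists_ultralimit (L := L) Filter.atTop
    (fun p (x : Σ t, Fin (k t)) => g p x.1 x.2)
  refine ⟨N, SN, e, a, fun p q hpq => ?_, fun t => ?_⟩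
  · by_contra hne
    have := H ((Term.var p).equal (Term.var q)).not ?_
    · simp [hpq] at this
    · simp only [Formula.realize_not, Formula.realize_equal, Term.realize_var]
      rcases p with x | ⟨t, i⟩ <;> rcases q with y | ⟨t', j⟩
      · exact Filter.Eventually.of_forall fun _ h => hne (congrArg _ h)
      · filter_upwards [Filter.eventually_ge_atTop ({t'}, {x})] with p hp heq
        exact (hg p t' (hp.1 (by simp))).2.1 j (hp.2 (by simpa using heq.symm))
      · filter_upwards [Filter.eventually_ge_atTop ({t}, {y})] with p hp heq
        exact (hg p t (hp.1 (by simp))).2.1 i (hp.2 (by simpa using heq))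
      · filter_upwards [Filter.eventually_ge_atTop ({t, t'}, ∅)] with p hp heq
        have ht := hp.1 (show t ∈ ({t, t'} : Finset ι) by simp)
        by_cases htt' : t = t'
        · subst htt'
          obtain rfl := (hg p t ht).1 heq
          exact hne rfl
        · exact hdisj p t ht t' (hp.1 (by simp)) htt' i j heq
  · have := H ((φ t).relabel (Sum.elim (fun i => Sum.inr ⟨t, i⟩) (Sum.inl ∘ b t))) ?_
    · rw [Formula.realize_relabel] at this
      convert this using 1
      funext x
      cases x <;> rfl
    · filter_upwards [Filter.eventually_ge_atTop ({t}, ∅)] with p hp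
      rw [Formula.realize_relabel]
      convert (hg p t (hp.1 (by simp))).2.2 using 1
      funext x
      cases x <;> rfl

/-- Infinite structures in disjoint languages sharing a set have elementary extensions with the same
underlying set, over the common part. -/
theorem exists_elementary_amalgam {L₁ L₂ : FirstOrder.Language.{u, v}} {β N₁ N₂ : Type (max u v)}
    [L₁.Structure N₁] [L₂.Structure N₂] [Infinite N₁] [Infinite N₂] (f₁ : β → N₁) (f₂ : β → N₂)
    (hf₁ : Function.Injective f₁) (hf₂ : Function.Injective f₂) :
    ∃ (N : Type (max u v)) (_ : L₁.Structure N) (_ : L₂.Structure N) (e₁ : N₁ ↪ₑ[L₁] N)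
      (e₂ : N₂ ↪ₑ[L₂] N), e₁ ∘ f₁ = e₂ ∘ f₂ := by
  let κ : Cardinal.{max u v} := max (max (Order.succ (Cardinal.mk β)) (max (Cardinal.mk N₁)
    (Cardinal.mk N₂))) (max L₁.card L₂.card)
  obtain ⟨⟨P₁, _⟩, ⟨i₁⟩, hP₁⟩ := exists_elementaryEmbedding_card_eq_of_ge L₁ N₁ κ
    (by simp [κ]) (by simp [κ])
  obtain ⟨⟨P₂, _⟩, ⟨i₂⟩, hP₂⟩ := exists_elementaryEmbedding_card_eq_of_ge L₂ N₂ κ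
    (by simp [κ]) (by simp [κ])
  have hinj₁ : Function.Injective (i₁ ∘ f₁) := i₁.injective.comp hf₁
  let r : β ≃ Set.range (i₁ ∘ f₁) := Equiv.ofInjective _ hinj₁
  have hcard : Cardinal.mk P₁ = Cardinal.mk P₂ := hP₁.trans hP₂.symm
  obtain ⟨g, hg⟩ := Cardinal.extend_function_of_lt
    (⟨i₂ ∘ f₂ ∘ r.symm, i₂.injective.comp (hf₂.comp r.symm.injective)⟩ :
      Set.range (i₁ ∘ f₁) ↪ P₂)
    (by
      rw [← Cardinal.mk_congr r]
      exact (Order.lt_succ _).trans_le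
        ((by simp [κ] : Order.succ (Cardinal.mk β) ≤ κ).trans hP₁.ge))
    (Cardinal.eq.1 hcard)
  let : L₁.Structure P₂ := g.inducedStructure
  refine ⟨P₂, g.inducedStructure, inferInstance,
    g.inducedStructureEquiv.toElementaryEmbedding.comp i₁, i₂, funext fun x => ?_⟩
  have hx : (r x : P₁) = i₁ (f₁ x) := rfl
  have := hg (r x)
  rw [hx] at this
  simpa using this

theorem realize_of_directed_union {G : ℕ → Type*} [∀ n, L.Structure (G n)] {N : Type*}
    [L.Structure N] (j : ∀ n, G n ↪[L] N)
    (hj : ∀ m n, m ≤ n → ∃ e : G m ↪ₑ[L] G n, ∀ x, j n (e x) = j m x)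
    (hsurj : ∀ y, ∃ n x, j n x = y) {α : Type*} {l : ℕ} (φ : L.BoundedFormula α l) :
    ∀ (n : ℕ) (v : α → G n) (xs : Fin l → G n),
      φ.Realize (j n ∘ v) (j n ∘ xs) ↔ φ.Realize v xs := by
  induction φ with
  | falsum => exact fun _ _ _ => Iff.rfl
  | equal t₁ t₂ =>
    intro n v xs
    simp only [BoundedFormula.Realize, ← Sum.comp_elim, HomClass.realize_term]
    exact (j n).injective.eq_iff
  | rel R ts =>
    intro n v xs
    simp only [BoundedFormula.Realize, ← Sum.comp_elim, HomClass.realize_term]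
    exact (j n).map_rel R _
  | imp _ _ ih₁ ih₂ =>
    intro n v xs
    simp only [BoundedFormula.realize_imp, ih₁, ih₂]
  | all φ ih =>
    intro n v xs
    simp only [BoundedFormula.realize_all]
    refine ⟨fun h x => ?_, fun h y => ?_⟩
    · rw [← ih, Fin.comp_snoc]
      exact h (j n x)
    · obtain ⟨m, x, rfl⟩ := hsurj y
      obtain ⟨e, he⟩ := hj n (max n m) (le_max_left _ _)
      obtain ⟨e', he'⟩ := hj m (max n m) (le_max_right _ _)
      have h' : φ.all.Realize (e ∘ v) (e ∘ xs) := (e.map_boundedFormula _ _ _).2 h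
      have := (ih _ _ _).2 (BoundedFormula.realize_all.1 h' (e' x))
      have hc : j (max n m) ∘ e = j n := funext he
      rwa [Fin.comp_snoc, he', ← Function.comp_assoc, ← Function.comp_assoc, hc] at this

/-- The inclusion of a member of an elementary chain in the union of the chain. -/
def elementaryEmbeddingOfDirectedUnion {G : ℕ → Type*} [∀ n, L.Structure (G n)] {N : Type*}
    [L.Structure N] (j : ∀ n, G n ↪[L] N)
    (hj : ∀ m n, m ≤ n → ∃ e : G m ↪ₑ[L] G n, ∀ x, j n (e x) = j m x)
    (hsurj : ∀ y, ∃ n x, j n x = y) (n : ℕ) : G n ↪ₑ[L] N where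
  toFun := j n
  map_formula' l φ x := by
    have := realize_of_directed_union j hj hsurj φ n x default
    rwa [Subsingleton.elim (j n ∘ default) default] at this

/-- A chain of models in which every embedding of a model in its successor has a prescribed
property, together with its direct limit. -/
theorem exists_chain {T : L.Theory}
    (P : ∀ M N : Theory.ModelType.{u, v, max u v} T, (M ↪[L] N) → Prop)
    (hP : ∀ M, ∃ N f, P M N f) (M : Theory.ModelType.{u, v, max u v} T) :
    ∃ (G : ℕ → Theory.ModelType.{u, v, max u v} T) (N : Type (max u v)) (_ : L.Structure N)
      (j : ∀ n, G n ↪[L] N), Nonempty (M ↪[L] N) ∧ (∀ x, ∃ n y, j n y = x) ∧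
      (∀ m n, m ≤ n → ∃ e : G m ↪[L] G n, ∀ x, j n (e x) = j m x) ∧
      ∀ n, ∃ f : G n ↪[L] G (n + 1), P _ _ f ∧ ∀ x, j (n + 1) (f x) = j n x := by
  choose S s hs using hP
  obtain ⟨G, rfl, hG⟩ : ∃ G : ℕ → Theory.ModelType.{u, v, max u v} T,
      G 0 = M ∧ ∀ n, G (n + 1) = S (G n) := ⟨fun n => Nat.rec M (fun _ => S) n, rfl, fun _ => rfl⟩
  have hf : ∀ n, ∃ f : G n ↪[L] G (n + 1), P _ _ f := fun n => by
    rw [hG n]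
    exact ⟨s _, hs _⟩
  choose f hf using hf
  have hj : ∀ m n (h : m ≤ n) x, DirectLimit.of L ℕ (fun n => G n) (DirectedSystem.natLERec f) n
      (DirectedSystem.natLERec f m n h x) =
      DirectLimit.of L ℕ (fun n => G n) (DirectedSystem.natLERec f) m x :=
    fun m n h x => DirectLimit.of_f
  refine ⟨G, Language.DirectLimit (fun n => G n) (DirectedSystem.natLERec f), inferInstance,
    fun n => DirectLimit.of L ℕ (fun n => G n) (DirectedSystem.natLERec f) n,
    ⟨DirectLimit.of L ℕ (fun n => G n) (DirectedSystem.natLERec f) 0⟩, DirectLimit.exists_of,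
    fun m n h => ⟨_, hj m n h⟩, fun n => ⟨f n, hf n, fun x => ?_⟩⟩
  rw [← hj n (n + 1) n.le_succ, DirectedSystem.coe_natLERec]
  exact congrArg _ (Nat.leRecOn_succ' (C := fun n => G n) (next := fun {k} => f k) x).symm

theorem IsLargeIn.of_elementaryEmbedding {k m : ℕ} {φ : L.Formula (Fin k ⊕ Fin m)}
    {M N : Type (max u v)} [L.Structure M] [L.Structure N] (e : M ↪ₑ[L] N) {b : Fin m → M}
    (h : IsLargeIn φ N (e ∘ b)) : IsLargeIn φ M b := by
  obtain ⟨P, SP, f, a, h⟩ := h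
  exact ⟨P, SP, f.comp e, a, h⟩

/-- An embedding between models of a model complete theory, as an elementary embedding. -/
def IsModelComplete.elementaryEmbedding {T : L.Theory} (h : IsModelComplete T)
    {M N : Type (max u v)} [L.Structure M] [L.Structure N] (hM : M ⊨ T) (hN : N ⊨ T)
    (f : M ↪[L] N) : M ↪ₑ[L] N where
  toFun := f
  map_formula' := h M N hM hN f

/-- Robinson's test for model completeness. -/
theorem isModelComplete_of_exists_elementaryEmbedding {T : L.Theory}
    (h : ∀ (M N : Type (max u v)) [L.Structure M] [L.Structure N], M ⊨ T → N ⊨ T →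
      ∀ f : M ↪[L] N, ∃ (P : Type (max u v)) (_ : L.Structure P) (e : M ↪ₑ[L] P)
        (g : N ↪[L] P), ∀ x, g (f x) = e x) : IsModelComplete T := by
  have key : ∀ {α : Type} {l : ℕ} (φ : L.BoundedFormula α l) (M N : Type (max u v))
      [L.Structure M] [L.Structure N], M ⊨ T → N ⊨ T → ∀ (f : M ↪[L] N) (w : α → M)
      (xs : Fin l → M), φ.Realize (f ∘ w) (f ∘ xs) ↔ φ.Realize w xs := by
    intro α l φ
    induction φ with
    | falsum => intros; rfl
    | equal t₁ t₂ =>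
      intro M N _ _ _ _ f w xs
      simp only [BoundedFormula.Realize, ← Sum.comp_elim, HomClass.realize_term]
      exact f.injective.eq_iff
    | rel R ts =>
      intro M N _ _ _ _ f w xs
      simp only [BoundedFormula.Realize, ← Sum.comp_elim, HomClass.realize_term]
      exact f.map_rel R _
    | imp _ _ ih₁ ih₂ =>
      intro M N _ _ hM hN f w xs
      simp only [BoundedFormula.realize_imp, ih₁ M N hM hN, ih₂ M N hM hN]
    | all φ ih =>
      intro M N _ _ hM hN f w xs
      refine ⟨fun hφ x => ?_, fun hφ y => ?_⟩
      · rw [← ih M N hM hN f, Fin.comp_snoc]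
        exact hφ (f x)
      · obtain ⟨P, _, e, g, hge⟩ := h M N hM hN f
        have hP : P ⊨ T := (e.theory_model_iff T).1 hM
        have h₁ := (e.map_boundedFormula φ.all w xs).2 hφ (g y)
        have hc : ⇑g ∘ ⇑f = e := funext hge
        rw [← hc, Function.comp_assoc, Function.comp_assoc, ← Fin.comp_snoc, ih N P hN hP] at h₁
        exact h₁
  intro M N _ _ hM hN f n φ w
  have := key φ M N hM hN f w default
  rwa [Subsingleton.elim (f ∘ default) default] at this

section Expansion

variable {L₁ L₂ : FirstOrder.Language.{u, v}}

/-- An embedding of structures is also an embedding for any smaller language. -/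
def reductEmbedding {L' : FirstOrder.Language.{u, v}} (ϕ : L →ᴸ L') {M N : Type*} [L.Structure M]
    [L'.Structure M] [ϕ.IsExpansionOn M] [L.Structure N] [L'.Structure N] [ϕ.IsExpansionOn N]
    (f : M ↪[L'] N) : M ↪[L] N where
  toFun := f
  inj' := f.injective
  map_fun' F x := by
    have := f.map_fun (ϕ.onFunction F) x
    rwa [ϕ.map_onFunction, ϕ.map_onFunction] at this
  map_rel' R x := by
    have := f.map_rel (ϕ.onRelation R) x
    rwa [ϕ.map_onRelation, ϕ.map_onRelation] at this

/-- A map which is an embedding for both `L₁` and `L₂` is one for their disjoint union. -/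
def sumEmbedding {M N : Type*} [L₁.Structure M] [L₂.Structure M] [(L₁.sum L₂).Structure M]
    [(LHom.sumInl : L₁ →ᴸ L₁.sum L₂).IsExpansionOn M]
    [(LHom.sumInr : L₂ →ᴸ L₁.sum L₂).IsExpansionOn M]
    [L₁.Structure N] [L₂.Structure N] [(L₁.sum L₂).Structure N]
    [(LHom.sumInl : L₁ →ᴸ L₁.sum L₂).IsExpansionOn N]
    [(LHom.sumInr : L₂ →ᴸ L₁.sum L₂).IsExpansionOn N]
    (f₁ : M ↪[L₁] N) (f₂ : M ↪[L₂] N) (h : ⇑f₁ = f₂) : M ↪[L₁.sum L₂] N where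
  toFun := f₁
  inj' := f₁.injective
  map_fun' F x := by
    rcases F with F | F
    · have := f₁.map_fun F x
      rwa [← (LHom.sumInl : L₁ →ᴸ L₁.sum L₂).map_onFunction,
        ← (LHom.sumInl : L₁ →ᴸ L₁.sum L₂).map_onFunction] at this
    · have := f₂.map_fun F x
      rw [← (LHom.sumInr : L₂ →ᴸ L₁.sum L₂).map_onFunction,
        ← (LHom.sumInr : L₂ →ᴸ L₁.sum L₂).map_onFunction] at this
      change f₁ _ = Structure.funMap _ (f₁ ∘ x)
      rw [h]
      exact this
  map_rel' R x := by
    rcases R with R | R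
    · have := f₁.map_rel R x
      rwa [← (LHom.sumInl : L₁ →ᴸ L₁.sum L₂).map_onRelation,
        ← (LHom.sumInl : L₁ →ᴸ L₁.sum L₂).map_onRelation] at this
    · have := f₂.map_rel R x
      rw [← (LHom.sumInr : L₂ →ᴸ L₁.sum L₂).map_onRelation,
        ← (LHom.sumInr : L₂ →ᴸ L₁.sum L₂).map_onRelation] at this
      change Structure.RelMap _ (f₁ ∘ x) ↔ _
      rw [h]
      exact this

/-- A map preserving the formulas satisfied by the tuple of all elements, as an elementary
embedding. -/
def elementaryEmbeddingOfRealize {M N : Type*} [L.Structure M] [L.Structure N] (f : M → N)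
    (h : ∀ φ : L.Formula M, φ.Realize id → φ.Realize f) : M ↪ₑ[L] N where
  toFun := f
  map_formula' n φ x := by
    have h₁ := h (φ.relabel x)
    have h₂ := h (φ.relabel x).not
    simp only [Formula.realize_not, Formula.realize_relabel, Function.id_comp] at h₁ h₂
    exact ⟨fun hf => by_contra fun hx => h₂ hx hf, h₁⟩

/-- The genericity property of a set carrying both an `L₁`- and an `L₂`-structure. -/
def IsGeneric (L₁ L₂ : FirstOrder.Language.{u, v}) (M : Type (max u v)) [L₁.Structure M]
    [L₂.Structure M] : Prop :=
  ∀ (k m : ℕ) (φ₁ : L₁.Formula (Fin k ⊕ Fin m)) (φ₂ : L₂.Formula (Fin k ⊕ Fin m))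
    (b : Fin m → M), IsLargeIn φ₁ M b → IsLargeIn φ₂ M b →
    ∃ a : Fin k → M, φ₁.Realize (Sum.elim a b) ∧ φ₂.Realize (Sum.elim a b)

theorem IsGeneric.exists_retraction {M N : Type (max u v)} [Nonempty M] [L₁.Structure M]
    [L₂.Structure M] [L₁.Structure N] [L₂.Structure N] (hgen : IsGeneric L₁ L₂ M)
    (e₁ : M ↪ₑ[L₁] N) (e₂ : M ↪ₑ[L₂] N) (he : ⇑e₁ = e₂) (φ₁ : L₁.Formula N) (φ₂ : L₂.Formula N)
    (h₁ : φ₁.Realize id) (h₂ : φ₂.Realize id) :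
    ∃ r : N → M, (∀ x, r (e₁ x) = x) ∧ φ₁.Realize r ∧ φ₂.Realize r := by
  classical
  let s : Finset N := φ₁.freeVarFinset ∪ φ₂.freeVarFinset
  let A : Finset N := s.filter (· ∉ Set.range e₁)
  let B : Finset M := s.preimage e₁ e₁.injective.injOn
  let a : Fin A.card → N := fun i => A.equivFin.symm i
  let b : Fin B.card → M := fun i => B.equivFin.symm i
  have ha : Function.Injective a := Subtype.val_injective.comp A.equivFin.symm.injective
  have haA : ∀ i, a i ∉ Set.range e₁ := fun i =>
    (Finset.mem_filter.1 (A.equivFin.symm i).2).2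
  have hs : ∀ x ∈ s, ∃ y, Sum.elim a (e₁ ∘ b) y = x := by
    intro x hx
    by_cases hxr : x ∈ Set.range e₁
    · obtain ⟨z, rfl⟩ := hxr
      exact ⟨Sum.inr (B.equivFin ⟨z, Finset.mem_preimage.2 hx⟩), by simp [b]⟩
    · exact ⟨Sum.inl (A.equivFin ⟨x, Finset.mem_filter.2 ⟨hx, hxr⟩⟩), by simp [a]⟩
  choose c hc using fun x : s => hs x x.2
  have hc₁ : ∀ x : φ₁.freeVarFinset,
      Sum.elim a (e₁ ∘ b) (c ⟨x, Finset.mem_union_left _ x.2⟩) = x := fun x => hc _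
  have hc₂ : ∀ x : φ₂.freeVarFinset,
      Sum.elim a (e₁ ∘ b) (c ⟨x, Finset.mem_union_right _ x.2⟩) = x := fun x => hc _
  let ψ₁ : L₁.Formula (Fin A.card ⊕ Fin B.card) := φ₁.restrictFreeVar
    fun x => c ⟨x, Finset.mem_union_left _ x.2⟩
  let ψ₂ : L₂.Formula (Fin A.card ⊕ Fin B.card) := φ₂.restrictFreeVar
    fun x => c ⟨x, Finset.mem_union_right _ x.2⟩
  have hψ₁ : IsLargeIn ψ₁ M b := ⟨N, inferInstance, e₁, a, ha,
    fun i hi => haA i (acl_range_comp_subset e₁ b hi),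
    (BoundedFormula.realize_restrictFreeVar id hc₁).2 h₁⟩
  have hψ₂ : IsLargeIn ψ₂ M b := ⟨N, inferInstance, e₂, a, ha,
    fun i hi => haA i (he ▸ acl_range_comp_subset e₂ b hi),
    (BoundedFormula.realize_restrictFreeVar id (he ▸ hc₂)).2 h₂⟩
  obtain ⟨a', ha'₁, ha'₂⟩ := hgen _ _ ψ₁ ψ₂ b hψ₁ hψ₂
  let r : N → M := fun x => if hx : ∃ z, e₁ z = x then hx.choose else
    if hx : ∃ i, a i = x then a' hx.choose else Classical.arbitrary M
  have hre : ∀ x, r (e₁ x) = x := fun x => by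
    have hx : ∃ z, e₁ z = e₁ x := ⟨x, rfl⟩
    simp only [r, dif_pos hx]
    exact e₁.injective hx.choose_spec
  have hra : ∀ i, r (a i) = a' i := fun i => by
    have hx : ∃ j, a j = a i := ⟨i, rfl⟩
    simp only [r, dif_neg (show ¬ ∃ z, e₁ z = a i from haA i), dif_pos hx]
    exact congrArg a' (ha hx.choose_spec)
  have hr : ∀ y, Sum.elim a' b y = r (Sum.elim a (e₁ ∘ b) y) := by
    rintro (i | i)
    · exact (hra i).symm
    · exact (hre (b i)).symm
  refine ⟨r, hre, ?_, ?_⟩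
  · exact (BoundedFormula.realize_restrictFreeVar r fun x => by rw [hr, hc₁]).1 ha'₁
  · exact (BoundedFormula.realize_restrictFreeVar r fun x => by rw [hr, hc₂]).1 ha'₂

theorem IsGeneric.exists_amalgam {M N : Type (max u v)} [Nonempty M]
    [L₁.Structure M] [L₂.Structure M] [(L₁.sum L₂).Structure M]
    [(LHom.sumInl : L₁ →ᴸ L₁.sum L₂).IsExpansionOn M]
    [(LHom.sumInr : L₂ →ᴸ L₁.sum L₂).IsExpansionOn M]
    [L₁.Structure N] [L₂.Structure N] [(L₁.sum L₂).Structure N]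
    [(LHom.sumInl : L₁ →ᴸ L₁.sum L₂).IsExpansionOn N]
    [(LHom.sumInr : L₂ →ᴸ L₁.sum L₂).IsExpansionOn N]
    (hgen : IsGeneric L₁ L₂ M) (e₁ : M ↪ₑ[L₁] N) (e₂ : M ↪ₑ[L₂] N) (he : ⇑e₁ = e₂) :
    ∃ (P : Type (max u v)) (_ : (L₁.sum L₂).Structure P) (e : M ↪ₑ[L₁.sum L₂] P)
      (g : N ↪[L₁.sum L₂] P), ∀ x, g (e₁ x) = e x := by
  classical
  have hret : ∀ p : Finset {φ : L₁.Formula N // φ.Realize id} ×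
      Finset {φ : L₂.Formula N // φ.Realize id}, ∃ r : N → M, (∀ x, r (e₁ x) = x) ∧
        (∀ φ ∈ p.1, φ.1.Realize r) ∧ ∀ φ ∈ p.2, φ.1.Realize r := by
    intro p
    obtain ⟨r, hr, h₁, h₂⟩ := hgen.exists_retraction e₁ e₂ he
      (Formula.iInf fun φ : p.1 => φ.1.1) (Formula.iInf fun φ : p.2 => φ.1.1)
      (Formula.realize_iInf.2 fun φ => φ.1.2) (Formula.realize_iInf.2 fun φ => φ.1.2)
    exact ⟨r, hr, fun φ hφ => Formula.realize_iInf.1 h₁ ⟨φ, hφ⟩,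
      fun φ hφ => Formula.realize_iInf.1 h₂ ⟨φ, hφ⟩⟩
  choose r hr hr₁ hr₂ using hret
  obtain ⟨P, SP, e, g, hg⟩ := exists_ultralimit (L := L₁.sum L₂) Filter.atTop r
  let : L₁.Structure P := (LHom.sumInl : L₁ →ᴸ L₁.sum L₂).reduct P
  let : L₂.Structure P := (LHom.sumInr : L₂ →ᴸ L₁.sum L₂).reduct P
  let g₁ : N ↪ₑ[L₁] P := elementaryEmbeddingOfRealize g fun φ hφ => by
    have := hg (((LHom.sumInl : L₁ →ᴸ L₁.sum L₂).onFormula φ).relabel Sum.inr) ?_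
    · rwa [Formula.realize_relabel, LHom.realize_onFormula, Sum.elim_comp_inr] at this
    · filter_upwards [Filter.eventually_ge_atTop ({⟨φ, hφ⟩}, ∅)] with p hp
      rw [Formula.realize_relabel, LHom.realize_onFormula, Sum.elim_comp_inr]
      exact hr₁ p _ (hp.1 (Finset.mem_singleton_self _))
  let g₂ : N ↪ₑ[L₂] P := elementaryEmbeddingOfRealize g fun φ hφ => by
    have := hg (((LHom.sumInr : L₂ →ᴸ L₁.sum L₂).onFormula φ).relabel Sum.inr) ?_
    · rwa [Formula.realize_relabel, LHom.realize_onFormula, Sum.elim_comp_inr] at this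
    · filter_upwards [Filter.eventually_ge_atTop (∅, {⟨φ, hφ⟩})] with p hp
      rw [Formula.realize_relabel, LHom.realize_onFormula, Sum.elim_comp_inr]
      exact hr₂ p _ (hp.2 (Finset.mem_singleton_self _))
  refine ⟨P, SP, e, sumEmbedding g₁.toEmbedding g₂.toEmbedding rfl, fun x => ?_⟩
  have := hg ((Term.var (Sum.inr (e₁ x))).equal (Term.var (Sum.inl x)))
    (Filter.Eventually.of_forall fun p => by simp [hr])
  exact (by simpa using this : g (e₁ x) = e x)

theorem exists_generic_step {M : Type (max u v)} [Infinite M] [L₁.Structure M] [L₂.Structure M] :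
    ∃ (N : Type (max u v)) (_ : L₁.Structure N) (_ : L₂.Structure N) (e₁ : M ↪ₑ[L₁] N)
      (e₂ : M ↪ₑ[L₂] N), ⇑e₁ = e₂ ∧
      ∀ (k m : ℕ) (φ₁ : L₁.Formula (Fin k ⊕ Fin m)) (φ₂ : L₂.Formula (Fin k ⊕ Fin m))
        (b : Fin m → M), IsLargeIn φ₁ M b → IsLargeIn φ₂ M b →
        ∃ a : Fin k → N, φ₁.Realize (Sum.elim a (e₁ ∘ b)) ∧ φ₂.Realize (Sum.elim a (e₁ ∘ b)) := by
  let ι : Type (max u v) := {t : Σ k m : ℕ, L₁.Formula (Fin k ⊕ Fin m) ×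
    L₂.Formula (Fin k ⊕ Fin m) × (Fin m → M) //
      IsLargeIn t.2.2.1 M t.2.2.2.2 ∧ IsLargeIn t.2.2.2.1 M t.2.2.2.2}
  obtain ⟨N₁, _, f₁, a₁, hinj₁, ha₁⟩ := exists_elementaryEmbedding_realize_family (L := L₁) (ι := ι)
    (fun t => t.1.1) (fun t => t.1.2.1) (fun t => t.1.2.2.1) (fun t => t.1.2.2.2.2)
    fun t => t.2.1
  obtain ⟨N₂, _, f₂, a₂, hinj₂, ha₂⟩ := exists_elementaryEmbedding_realize_family (L := L₂) (ι := ι)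
    (fun t => t.1.1) (fun t => t.1.2.1) (fun t => t.1.2.2.2.1) (fun t => t.1.2.2.2.2)
    fun t => t.2.2
  have := Infinite.of_injective f₁ f₁.injective
  have := Infinite.of_injective f₂ f₂.injective
  obtain ⟨N, S₁, S₂, e₁, e₂, he⟩ := exists_elementary_amalgam (L₁ := L₁) (L₂ := L₂) _ _ hinj₁ hinj₂
  have hM : ⇑e₁ ∘ f₁ = e₂ ∘ f₂ := funext fun x => congrFun he (Sum.inl x)
  have ha : ∀ x, e₁ (a₁ x) = e₂ (a₂ x) := fun x => congrFun he (Sum.inr x)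
  refine ⟨N, S₁, S₂, e₁.comp f₁, e₂.comp f₂, hM, fun k m φ₁ φ₂ b h₁ h₂ => ?_⟩
  let t : ι := ⟨⟨k, m, φ₁, φ₂, b⟩, h₁, h₂⟩
  refine ⟨fun i => e₁ (a₁ ⟨t, i⟩), ?_, ?_⟩
  · have := (e₁.map_formula φ₁ _).2 (ha₁ t)
    rwa [Sum.comp_elim] at this
  · have := (e₂.map_formula φ₂ _).2 (ha₂ t)
    rw [Sum.comp_elim, ← Function.comp_assoc, ← hM] at this
    simp only [ha]
    exact this

theorem exists_embedding_realize_large {T₁ : L₁.Theory} {T₂ : L₂.Theory}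
    (hinf : OnlyInfiniteModels T₁)
    (M : Theory.ModelType.{u, v, max u v} ((LHom.sumInl : L₁ →ᴸ L₁.sum L₂).onTheory T₁ ∪
      (LHom.sumInr : L₂ →ᴸ L₁.sum L₂).onTheory T₂)) :
    ∃ (N : Theory.ModelType.{u, v, max u v} ((LHom.sumInl : L₁ →ᴸ L₁.sum L₂).onTheory T₁ ∪
      (LHom.sumInr : L₂ →ᴸ L₁.sum L₂).onTheory T₂)) (f : M ↪[L₁.sum L₂] N),
      ∀ (k m : ℕ) (φ₁ : L₁.Formula (Fin k ⊕ Fin m)) (φ₂ : L₂.Formula (Fin k ⊕ Fin m))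
        (b : Fin m → M),
        @IsLargeIn L₁ k m φ₁ M ((LHom.sumInl : L₁ →ᴸ L₁.sum L₂).reduct M) b →
        @IsLargeIn L₂ k m φ₂ M ((LHom.sumInr : L₂ →ᴸ L₁.sum L₂).reduct M) b →
        ∃ a : Fin k → N,
          ((LHom.sumInl : L₁ →ᴸ L₁.sum L₂).onFormula φ₁).Realize (Sum.elim a (f ∘ b)) ∧
          ((LHom.sumInr : L₂ →ᴸ L₁.sum L₂).onFormula φ₂).Realize (Sum.elim a (f ∘ b)) := by
  let : L₁.Structure M := (LHom.sumInl : L₁ →ᴸ L₁.sum L₂).reduct M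
  let : L₂.Structure M := (LHom.sumInr : L₂ →ᴸ L₁.sum L₂).reduct M
  obtain ⟨hM₁, hM₂⟩ := Theory.model_union_iff.1 M.is_model
  rw [LHom.onTheory_model] at hM₁ hM₂
  have := hinf M hM₁
  obtain ⟨N, _, _, e₁, e₂, he, h⟩ := exists_generic_step (L₁ := L₁) (L₂ := L₂) (M := M)
  have hN : N ⊨ (LHom.sumInl : L₁ →ᴸ L₁.sum L₂).onTheory T₁ ∪
      (LHom.sumInr : L₂ →ᴸ L₁.sum L₂).onTheory T₂ := by
    rw [Theory.model_union_iff, LHom.onTheory_model, LHom.onTheory_model]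
    exact ⟨(e₁.theory_model_iff T₁).1 hM₁, (e₂.theory_model_iff T₂).1 hM₂⟩
  have : Nonempty N := Nonempty.map e₁ inferInstance
  refine ⟨⟨N⟩, sumEmbedding e₁.toEmbedding e₂.toEmbedding he, fun k m φ₁ φ₂ b h₁ h₂ => ?_⟩
  obtain ⟨a, ha⟩ := h k m φ₁ φ₂ b h₁ h₂
  exact ⟨a, (LHom.realize_onFormula _ φ₁).2 ha.1, (LHom.realize_onFormula _ φ₂).2 ha.2⟩

theorem exists_embedding_generic {T₁ : L₁.Theory} {T₂ : L₂.Theory}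
    (hinf : OnlyInfiniteModels T₁) (hmc₁ : IsModelComplete T₁) (hmc₂ : IsModelComplete T₂)
    (M : Theory.ModelType.{u, v, max u v} ((LHom.sumInl : L₁ →ᴸ L₁.sum L₂).onTheory T₁ ∪
      (LHom.sumInr : L₂ →ᴸ L₁.sum L₂).onTheory T₂)) :
    ∃ (N : Type (max u v)) (_ : (L₁.sum L₂).Structure N),
      N ⊨ (LHom.sumInl : L₁ →ᴸ L₁.sum L₂).onTheory T₁ ∧
      N ⊨ (LHom.sumInr : L₂ →ᴸ L₁.sum L₂).onTheory T₂ ∧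
      GenericityAxioms L₁ L₂ N ∧ Nonempty (M ↪[L₁.sum L₂] N) := by
  obtain ⟨G, N, _, j, hMN, hsurj, hj, hG⟩ := exists_chain _
    (exists_embedding_realize_large (T₁ := T₁) (T₂ := T₂) hinf) M
  let : ∀ n, L₁.Structure (G n) := fun n => (LHom.sumInl : L₁ →ᴸ L₁.sum L₂).reduct (G n)
  let : ∀ n, L₂.Structure (G n) := fun n => (LHom.sumInr : L₂ →ᴸ L₁.sum L₂).reduct (G n)
  let : L₁.Structure N := (LHom.sumInl : L₁ →ᴸ L₁.sum L₂).reduct N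
  let : L₂.Structure N := (LHom.sumInr : L₂ →ᴸ L₁.sum L₂).reduct N
  have hG₁ : ∀ n, G n ⊨ T₁ := fun n =>
    (LHom.onTheory_model _ _).1 (Theory.model_union_iff.1 (G n).is_model).1
  have hG₂ : ∀ n, G n ⊨ T₂ := fun n =>
    (LHom.onTheory_model _ _).1 (Theory.model_union_iff.1 (G n).is_model).2
  let j₁ : ∀ n, G n ↪ₑ[L₁] N := elementaryEmbeddingOfDirectedUnion
    (fun n => reductEmbedding (LHom.sumInl : L₁ →ᴸ L₁.sum L₂) (j n))
    (fun m n h => (hj m n h).imp' (fun e => hmc₁.elementaryEmbedding (hG₁ m) (hG₁ n)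
      (reductEmbedding (LHom.sumInl : L₁ →ᴸ L₁.sum L₂) e)) fun _ => id) hsurj
  let j₂ : ∀ n, G n ↪ₑ[L₂] N := elementaryEmbeddingOfDirectedUnion
    (fun n => reductEmbedding (LHom.sumInr : L₂ →ᴸ L₁.sum L₂) (j n))
    (fun m n h => (hj m n h).imp' (fun e => hmc₂.elementaryEmbedding (hG₂ m) (hG₂ n)
      (reductEmbedding (LHom.sumInr : L₂ →ᴸ L₁.sum L₂) e)) fun _ => id) hsurj
  have hlift : ∀ {m : ℕ} (b : Fin m → N), ∃ n, ∃ b' : Fin m → G n, b = j n ∘ b' := by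
    intro m b
    choose n y hy using fun i => hsurj (b i)
    choose e he using fun i => hj (n i) (Finset.univ.sup n) (Finset.le_sup (Finset.mem_univ i))
    exact ⟨_, fun i => e i (y i), funext fun i => by rw [Function.comp_apply, he, hy]⟩
  refine ⟨N, inferInstance, (LHom.onTheory_model _ _).2 ((j₁ 0).theory_model_iff T₁ |>.1 (hG₁ 0)),
    (LHom.onTheory_model _ _).2 ((j₂ 0).theory_model_iff T₂ |>.1 (hG₂ 0)),
    fun k m φ₁ φ₂ b h₁ h₂ => ?_, hMN⟩
  obtain ⟨n, b, rfl⟩ := hlift b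
  obtain ⟨f, hf, hsucc⟩ := hG n
  obtain ⟨a, ha₁, ha₂⟩ := hf k m φ₁ φ₂ b (h₁.of_elementaryEmbedding (j₁ n))
    (h₂.of_elementaryEmbedding (j₂ n))
  rw [LHom.realize_onFormula] at ha₁ ha₂
  have hjb : j (n + 1) ∘ f ∘ b = j n ∘ b := funext fun i => hsucc (b i)
  have hj₁ := ((j₁ (n + 1)).map_formula φ₁ _).2 ha₁
  have hj₂ := ((j₂ (n + 1)).map_formula φ₂ _).2 ha₂
  rw [Sum.comp_elim] at hj₁ hj₂
  rw [← hjb]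
  exact ⟨j (n + 1) ∘ a, hj₁, hj₂⟩

theorem exists_embedding_union {T₁' T₁ : L₁.Theory} {T₂' T₂ : L₂.Theory}
    (hmc₁ : IsModelCompanion T₁ T₁') (hmc₂ : IsModelCompanion T₂ T₂')
    (hinf₁ : OnlyInfiniteModels T₁) (hinf₂ : OnlyInfiniteModels T₂)
    {M : Type (max u v)} [(L₁.sum L₂).Structure M]
    (hM : M ⊨ (LHom.sumInl : L₁ →ᴸ L₁.sum L₂).onTheory T₁' ∪
      (LHom.sumInr : L₂ →ᴸ L₁.sum L₂).onTheory T₂') :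
    ∃ N : Theory.ModelType.{u, v, max u v} ((LHom.sumInl : L₁ →ᴸ L₁.sum L₂).onTheory T₁ ∪
      (LHom.sumInr : L₂ →ᴸ L₁.sum L₂).onTheory T₂), Nonempty (M ↪[L₁.sum L₂] N) := by
  let : L₁.Structure M := (LHom.sumInl : L₁ →ᴸ L₁.sum L₂).reduct M
  let : L₂.Structure M := (LHom.sumInr : L₂ →ᴸ L₁.sum L₂).reduct M
  rw [Theory.model_union_iff, LHom.onTheory_model, LHom.onTheory_model] at hM
  obtain ⟨N₁, _, hN₁, ⟨f₁⟩⟩ := hmc₁.2.1 M hM.1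
  obtain ⟨N₂, _, hN₂, ⟨f₂⟩⟩ := hmc₂.2.1 M hM.2
  have := hinf₁ N₁ hN₁
  have := hinf₂ N₂ hN₂
  obtain ⟨N, _, _, e₁, e₂, he⟩ := exists_elementary_amalgam (L₁ := L₁) (L₂ := L₂) f₁ f₂
    f₁.injective f₂.injective
  have hN : N ⊨ (LHom.sumInl : L₁ →ᴸ L₁.sum L₂).onTheory T₁ ∪
      (LHom.sumInr : L₂ →ᴸ L₁.sum L₂).onTheory T₂ := by
    rw [Theory.model_union_iff, LHom.onTheory_model, LHom.onTheory_model]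
    exact ⟨(e₁.theory_model_iff T₁).1 hN₁, (e₂.theory_model_iff T₂).1 hN₂⟩
  have : Nonempty N := Nonempty.map e₁ inferInstance
  exact ⟨⟨N⟩, ⟨sumEmbedding (e₁.toEmbedding.comp f₁) (e₂.toEmbedding.comp f₂) he⟩⟩

/-- The generic models of the union of two model complete theories form a model complete theory. -/
theorem isModelComplete_generic {T₁ : L₁.Theory} {T₂ : L₂.Theory}
    (hmc₁ : IsModelComplete T₁) (hmc₂ : IsModelComplete T₂) (hinf : OnlyInfiniteModels T₁)
    {T : (L₁.sum L₂).Theory}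
    (hT : ∀ (M : Type (max u v)) [(L₁.sum L₂).Structure M], M ⊨ T →
      (M ⊨ (LHom.sumInl : L₁ →ᴸ L₁.sum L₂).onTheory T₁ ∧
        M ⊨ (LHom.sumInr : L₂ →ᴸ L₁.sum L₂).onTheory T₂ ∧ GenericityAxioms L₁ L₂ M)) :
    IsModelComplete T := by
  refine isModelComplete_of_exists_elementaryEmbedding fun M N _ _ hM hN f => ?_
  let : L₁.Structure M := (LHom.sumInl : L₁ →ᴸ L₁.sum L₂).reduct M
  let : L₂.Structure M := (LHom.sumInr : L₂ →ᴸ L₁.sum L₂).reduct M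
  let : L₁.Structure N := (LHom.sumInl : L₁ →ᴸ L₁.sum L₂).reduct N
  let : L₂.Structure N := (LHom.sumInr : L₂ →ᴸ L₁.sum L₂).reduct N
  obtain ⟨hM₁, hM₂, hgen⟩ := hT M hM
  obtain ⟨hN₁, hN₂, -⟩ := hT N hN
  rw [LHom.onTheory_model] at hM₁ hM₂ hN₁ hN₂
  have := hinf M hM₁
  exact IsGeneric.exists_amalgam (L₁ := L₁) (L₂ := L₂) hgen
    (hmc₁.elementaryEmbedding hM₁ hN₁ (reductEmbedding LHom.sumInl f))
    (hmc₂.elementaryEmbedding hM₂ hN₂ (reductEmbedding LHom.sumInr f)) rfl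

end Expansion

/-- **Lemma 4.4**: Let `L = L₁ ∪ L₂` with `L₁ ∩ L₂ = ∅` (realized as the disjoint sum), let
`T_i'` be an `L_i`-theory with model companion `T_i ⊇ T_i'` eliminating `∃^∞`, where all of
`T₁, T₁', T₂, T₂'` have only infinite models, and let `T̃` be the `L`-theory axiomatized by
`T₁ ∪ T₂` together with the genericity axioms (here characterized semantically).  Then `T̃` is
the model companion of `T₁' ∪ T₂'`, and consequently also of `T₁ ∪ T₂'`, `T₁' ∪ T₂` and
`T₁ ∪ T₂`. -/
theorem generic_union_is_model_companion
    {L₁ L₂ : FirstOrder.Language.{u, v}}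
    (T₁' T₁ : L₁.Theory) (T₂' T₂ : L₂.Theory)
    (hsub₁ : T₁' ⊆ T₁) (hsub₂ : T₂' ⊆ T₂)
    (hmc₁ : IsModelCompanion T₁ T₁') (hmc₂ : IsModelCompanion T₂ T₂')
    (hee₁ : EliminatesExInf T₁) (hee₂ : EliminatesExInf T₂)
    (hinf₁ : OnlyInfiniteModels T₁) (hinf₁' : OnlyInfiniteModels T₁')
    (hinf₂ : OnlyInfiniteModels T₂) (hinf₂' : OnlyInfiniteModels T₂')
    (Ttilde : (L₁.sum L₂).Theory)
    (hchar : ∀ (M : Type (max u v)) [(L₁.sum L₂).Structure M],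
      M ⊨ Ttilde ↔
        (M ⊨ (LHom.sumInl : L₁ →ᴸ L₁.sum L₂).onTheory T₁ ∧
         M ⊨ (LHom.sumInr : L₂ →ᴸ L₁.sum L₂).onTheory T₂ ∧
         GenericityAxioms L₁ L₂ M)) :
    IsModelCompanion Ttilde
        ((LHom.sumInl : L₁ →ᴸ L₁.sum L₂).onTheory T₁' ∪
         (LHom.sumInr : L₂ →ᴸ L₁.sum L₂).onTheory T₂') ∧
    IsModelCompanion Ttilde
        ((LHom.sumInl : L₁ →ᴸ L₁.sum L₂).onTheory T₁ ∪
         (LHom.sumInr : L₂ →ᴸ L₁.sum L₂).onTheory T₂') ∧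
    IsModelCompanion Ttilde
        ((LHom.sumInl : L₁ →ᴸ L₁.sum L₂).onTheory T₁' ∪
         (LHom.sumInr : L₂ →ᴸ L₁.sum L₂).onTheory T₂) ∧
    IsModelCompanion Ttilde
        ((LHom.sumInl : L₁ →ᴸ L₁.sum L₂).onTheory T₁ ∪
         (LHom.sumInr : L₂ →ᴸ L₁.sum L₂).onTheory T₂) := by
  have hcomplete : IsModelComplete Ttilde :=
    isModelComplete_generic hmc₁.1 hmc₂.1 hinf₁ fun M _ => (hchar M).1
  have key : ∀ (S₁ : L₁.Theory) (S₂ : L₂.Theory), T₁' ⊆ S₁ → T₂' ⊆ S₂ → S₁ ⊆ T₁ → S₂ ⊆ T₂ →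
      IsModelCompanion Ttilde ((LHom.sumInl : L₁ →ᴸ L₁.sum L₂).onTheory S₁ ∪
        (LHom.sumInr : L₂ →ᴸ L₁.sum L₂).onTheory S₂) := by
    intro S₁ S₂ h₁ h₂ h₁' h₂'
    refine ⟨hcomplete, fun M _ hM => ?_, fun N _ hN => ?_⟩
    · obtain ⟨M', ⟨f⟩⟩ := exists_embedding_union hmc₁ hmc₂ hinf₁ hinf₂
        (hM.mono (Set.union_subset_union (Set.image_mono h₁) (Set.image_mono h₂)))
      obtain ⟨N, _, hN₁, hN₂, hN, ⟨g⟩⟩ := exists_embedding_generic hinf₁ hmc₁.1 hmc₂.1 M'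
      exact ⟨N, inferInstance, (hchar N).2 ⟨hN₁, hN₂, hN⟩, ⟨g.comp f⟩⟩
    · obtain ⟨hN₁, hN₂, -⟩ := (hchar N).1 hN
      exact ⟨N, inferInstance, (Theory.model_union_iff.2 ⟨hN₁, hN₂⟩).mono
        (Set.union_subset_union (Set.image_mono h₁') (Set.image_mono h₂')),
        ⟨Embedding.refl _ N⟩⟩
  exact ⟨key _ _ subset_rfl subset_rfl hsub₁ hsub₂, key _ _ hsub₁ subset_rfl subset_rfl hsub₂,
    key _ _ subset_rfl hsub₂ hsub₁ subset_rfl, key _ _ hsub₁ hsub₂ subset_rfl subset_rfl⟩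

end Companion

end NATPPaper
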